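/- Constant-coefficient (pointwise) form of the restricted reverse Khovanskii–Teissier inequality with an auxiliary polarization (inequality (3.6) in the paper's proof of its main theorem; the instance (k,l) = (n−2, 1) of the paper's Proposition 4.2): let n ≥ 2. For all positive definite n×n complex Hermitian matrices H, W, A and every positive semidefinite n×n complex Hermitian matrix N, the mixed discriminants satisfy (n−1) · D(H, A^{[n−2]}, W) · D(H, W^{[n−2]}, N) ≥ D(H, A^{[n−2]}, N) · D(H, W^{[n−1]}). In form language on ℂⁿ: for constant-coefficient positive (1,1)-forms H, ω, α and a constant-coefficient nonnegative (1,1)-form N, one has (n−1)(H∧α^{n−2}∧ω)(H∧ω^{n−2}∧N) ≥ (H∧α^{n−2}∧N)(H∧ω^{n−1}). -/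

import Mathlib

open Matrix
open scoped ComplexOrder

/-- The mixed discriminant of `n` complex `n × n` matrices:
`D(M₁, …, Mₙ) = (1/n!) · ∑_{σ ∈ Sₙ} det (matrix whose j-th column is the j-th column of M_{σ(j)})`.
This is the unique symmetric multilinear function with `D(M, …, M) = det M`; equivalently,
`(1/n!)` times the coefficient of `t₁⋯tₙ` in `det (t₁ M₁ + ⋯ + tₙ Mₙ)`.
For Hermitian inputs the value is real, so we take the real part. -/
noncomputable def mixedDisc (n : ℕ) (M : Fin n → Matrix (Fin n) (Fin n) ℂ) : ℝ :=
  (((n.factorial : ℂ))⁻¹ *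
    ∑ σ : Equiv.Perm (Fin n), (Matrix.of fun i j => M (σ j) i j).det).re

/-- The tuple of matrices consisting of `a` copies of `X`, then `b` copies of `Y`,
then copies of `Z` in the remaining slots. -/
def blocks3 (n a b : ℕ) (X Y Z : Matrix (Fin n) (Fin n) ℂ) :
    Fin n → Matrix (Fin n) (Fin n) ℂ :=
  fun i => if (i : ℕ) < a then X else if (i : ℕ) < a + b then Y else Z

theorem sum_eq_add_add_sum_erase_erase {ι F : Type*} [Fintype ι] [DecidableEq ι]
    [AddCommMonoid F] {i j : ι} (hij : i ≠ j) (f : ι → F) :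
    ∑ a, f a = f i + f j + ∑ a ∈ (Finset.univ.erase i).erase j, f a := by
  rw [← Finset.add_sum_erase _ _ (Finset.mem_univ i),
    ← Finset.add_sum_erase _ _ (Finset.mem_erase.2 ⟨hij.symm, Finset.mem_univ j⟩), add_assoc]

/-- A Cauchy–Schwarz type inequality for the mixed discriminant of two Gram matrices restricted
to a coordinate plane. -/
theorem two_plane_gram_inequality {ι E : Type*} [Fintype ι] [DecidableEq ι]
    [NormedAddCommGroup E] [InnerProductSpace ℂ E] (v : ι → E) (c : ι → ℂ) {i j : ι}
    (hij : i ≠ j) :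
    (‖v i‖ ^ 2 * ‖c j‖ ^ 2 + ‖v j‖ ^ 2 * ‖c i‖ ^ 2
        - 2 * (inner ℂ (c i • v i) (c j • v j)).re) * ∑ a, ‖v a‖ ^ 2 ≤
      (‖v i‖ ^ 2 + ‖v j‖ ^ 2) *
        ((∑ a, ‖v a‖ ^ 2) * (∑ a, ‖c a‖ ^ 2) - ‖∑ a, c a • v a‖ ^ 2) := by
  rw [sum_eq_add_add_sum_erase_erase hij (fun a => ‖v a‖ ^ 2),
    sum_eq_add_add_sum_erase_erase hij (fun a => ‖c a‖ ^ 2),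
    sum_eq_add_add_sum_erase_erase hij (fun a => c a • v a)]
  set s := (Finset.univ.erase i).erase j
  have hy : ‖c i • v i + c j • v j‖ ^ 2 = ‖v i‖ ^ 2 * ‖c i‖ ^ 2
      + 2 * (inner ℂ (c i • v i) (c j • v j)).re + ‖v j‖ ^ 2 * ‖c j‖ ^ 2 := by
    rw [@norm_add_sq ℂ, norm_smul, norm_smul]
    simp only [RCLike.re_to_complex]
    ring
  have hz : ‖∑ a ∈ s, c a • v a‖ ^ 2 ≤ (∑ a ∈ s, ‖v a‖ ^ 2) * ∑ a ∈ s, ‖c a‖ ^ 2 := by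
    refine le_trans (pow_le_pow_left₀ (norm_nonneg _) (norm_sum_le _ _) 2) ?_
    simp only [norm_smul]
    rw [mul_comm (∑ a ∈ s, ‖v a‖ ^ 2)]
    exact Finset.sum_mul_sq_le_sq_mul_sq _ _ _
  have hyz := norm_add_le (c i • v i + c j • v j) (∑ a ∈ s, c a • v a)
  have hyz2 := pow_le_pow_left₀ (norm_nonneg _) hyz 2
  generalize ‖c i • v i + c j • v j + ∑ a ∈ s, c a • v a‖ ^ 2 = t at *
  set α := ‖c i • v i + c j • v j‖
  set β := ‖∑ a ∈ s, c a • v a‖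
  set m := ∑ a ∈ s, ‖v a‖ ^ 2
  set r := ∑ a ∈ s, ‖c a‖ ^ 2
  have hα : 0 ≤ α := norm_nonneg _
  have hβ : 0 ≤ β := norm_nonneg _
  have hm : 0 ≤ m := by positivity
  have hr : 0 ≤ r := by positivity
  have key : 2 * ((‖v i‖ ^ 2 + ‖v j‖ ^ 2) * α * β) ≤
      (‖v i‖ ^ 2 + ‖v j‖ ^ 2) ^ 2 * r + m * α ^ 2 := by
    set l := ‖v i‖ ^ 2 + ‖v j‖ ^ 2
    refine (pow_le_pow_iff_left₀ (by positivity) (by positivity) two_ne_zero).1 ?_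
    have h1 := mul_le_mul_of_nonneg_left hz (by positivity : 0 ≤ 4 * (l * α) ^ 2)
    nlinarith [sq_nonneg (l ^ 2 * r - m * α ^ 2)]
  have hl : 0 ≤ ‖v i‖ ^ 2 + ‖v j‖ ^ 2 := by positivity
  have h2 := mul_le_mul_of_nonneg_left hz hl
  have h3 := mul_le_mul_of_nonneg_left hyz2 hl
  generalize (inner ℂ (c i • v i) (c j • v j)).re = q at *
  have hq : 2 * q = α ^ 2 - ‖v i‖ ^ 2 * ‖c i‖ ^ 2 - ‖v j‖ ^ 2 * ‖c j‖ ^ 2 := by linarith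
  rw [hq]
  nlinarith

/-- The determinant of the identity matrix with two columns replaced. -/
theorem det_one_update_two_cols {n : Type*} [Fintype n] [DecidableEq n] (Y Z : Matrix n n ℂ)
    {p q : n} (hpq : p ≠ q) :
    (Matrix.of fun i j => if j = p then Y i j else if j = q then Z i j else
      (1 : Matrix n n ℂ) i j).det = Y p p * Z q q - Y q p * Z p q := by
  have h : (Matrix.of fun i j => if j = p then Y i j else if j = q then Z i j else
      (1 : Matrix n n ℂ) i j) = 1 +
      (Matrix.of fun i (k : Fin 2) => ![Y i p - (1 : Matrix n n ℂ) i p,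
        Z i q - (1 : Matrix n n ℂ) i q] k) *
      (Matrix.of fun (k : Fin 2) j => ![(1 : Matrix n n ℂ) p j, (1 : Matrix n n ℂ) q j] k) := by
    ext i j
    simp only [of_apply, Matrix.add_apply, Matrix.mul_apply, Fin.sum_univ_two]
    by_cases h1 : j = p
    · subst h1
      simp [Matrix.one_apply, hpq.symm]
    · by_cases h2 : j = q
      · subst h2
        simp [Matrix.one_apply, hpq, h1]
      · simp [Matrix.one_apply, h1, h2, Ne.symm h1, Ne.symm h2]
  rw [h, det_one_add_mul_comm, det_fin_two]
  simp [Matrix.mul_apply, Matrix.one_apply, hpq, hpq.symm]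
  ring

theorem exists_perm_map_pair {α : Type*} [DecidableEq α] {a b c d : α} (h : a ≠ b)
    (hcd : c ≠ d) : ∃ τ : Equiv.Perm α, τ a = c ∧ τ b = d := by
  refine ⟨Equiv.swap a c |>.trans (Equiv.swap (Equiv.swap a c b) d), ?_, ?_⟩
  · simp only [Equiv.trans_apply, Equiv.swap_apply_left]
    refine Equiv.swap_apply_of_ne_of_ne ?_ hcd
    intro e
    exact h (by simpa using congrArg (Equiv.swap a c) e)
  · simp

theorem sum_perm_apply_pair {α : Type*} [Fintype α] [DecidableEq α] (f : α → α → ℂ)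
    (hf : ∀ p, f p p = 0) {a b : α} (hab : a ≠ b) :
    (Fintype.card α : ℂ) * ((Fintype.card α : ℂ) - 1) * ∑ σ : Equiv.Perm α, f (σ a) (σ b) =
      ((Fintype.card α).factorial : ℂ) * ∑ p, ∑ q, f p q := by
  have h1 (p q : α) : ∑ σ : Equiv.Perm α, f (σ p) (σ q) =
      if p = q then 0 else ∑ σ : Equiv.Perm α, f (σ a) (σ b) := by
    split_ifs with h
    · simp [h, hf]
    · obtain ⟨τ, rfl, rfl⟩ := exists_perm_map_pair hab h
      exact Equiv.sum_comp (Equiv.mulRight τ) (fun σ : Equiv.Perm α => f (σ a) (σ b))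
  have h2 : ∑ p, ∑ q, ∑ σ : Equiv.Perm α, f (σ p) (σ q) =
      ((Fintype.card α).factorial : ℂ) * ∑ p, ∑ q, f p q := by
    calc _ = ∑ σ : Equiv.Perm α, ∑ p, ∑ q, f (σ p) (σ q) := by
          rw [Finset.sum_comm]
          rw [Finset.sum_comm (s := (Finset.univ : Finset (Equiv.Perm α)))]
          rw [Finset.sum_comm]
          exact Finset.sum_congr rfl fun p _ => Finset.sum_comm
      _ = ∑ σ : Equiv.Perm α, ∑ p, ∑ q, f p q := by
          refine Finset.sum_congr rfl fun σ _ => ?_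
          rw [← Equiv.sum_comp σ (fun p => ∑ q, f p q)]
          exact Finset.sum_congr rfl fun p _ => Equiv.sum_comp σ (f (σ p))
      _ = _ := by simp [Fintype.card_perm]
  rw [← h2]
  rw [Finset.sum_congr rfl fun p _ => Finset.sum_congr rfl fun q _ => h1 p q]
  generalize ∑ σ : Equiv.Perm α, f (σ a) (σ b) = S at *
  have h3 (p : α) : (∑ q, if p = q then 0 else S) =
      ((Fintype.card α : ℂ) - 1) * S := by
    have : ∀ q, (if p = q then 0 else S) =
      S -
        if p = q then S else 0 := by
      intro q; split_ifs <;> simp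
    simp only [this, Finset.sum_sub_distrib]
    simp
    ring
  simp only [h3]
  simp
  ring

/-- The mixed discriminant with all but two arguments equal to an invertible matrix. -/
theorem mixedDisc_blocks3 {n : ℕ} (hn : 2 ≤ n) (H A X : Matrix (Fin n) (Fin n) ℂ)
    (hA : IsUnit A.det) :
    mixedDisc n (blocks3 n 1 (n - 2) H A X) =
      (A.det * ((A⁻¹ * H).trace * (A⁻¹ * X).trace - (A⁻¹ * H * (A⁻¹ * X)).trace)).re /
        (n * (n - 1)) := by
  set a : Fin n := ⟨0, by lia⟩
  set b : Fin n := ⟨n - 1, by lia⟩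
  have hab : a ≠ b := by simp [a, b, Fin.ext_iff]; lia
  set Y := A⁻¹ * H
  set Z := A⁻¹ * X
  have hdet (σ : Equiv.Perm (Fin n)) :
      (Matrix.of fun i j => blocks3 n 1 (n - 2) H A X (σ j) i j).det =
      A.det * (Y (σ⁻¹ a) (σ⁻¹ a) * Z (σ⁻¹ b) (σ⁻¹ b)
        - Y (σ⁻¹ b) (σ⁻¹ a) * Z (σ⁻¹ a) (σ⁻¹ b)) := by
    rw [← det_one_update_two_cols Y Z (σ⁻¹.injective.ne hab), ← det_mul]
    congr 1
    ext i j
    have e1 : A * Y = H := mul_nonsing_inv_cancel_left _ _ hA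
    have e2 : A * Z = X := mul_nonsing_inv_cancel_left _ _ hA
    rw [Matrix.mul_apply]
    simp only [of_apply, blocks3]
    have i1 : ((σ j : Fin n) : ℕ) < 1 ↔ j = σ⁻¹ a := by
      rw [Equiv.Perm.eq_inv_iff_eq, Fin.ext_iff]
      simp [a]
    have i2 : ¬ ((σ j : Fin n) : ℕ) < 1 + (n - 2) ↔ j = σ⁻¹ b := by
      rw [Equiv.Perm.eq_inv_iff_eq, Fin.ext_iff]
      have := (σ j).isLt
      simp only [b]
      lia
    simp only [← i2, i1]
    split_ifs with h1 h2
    · rw [← Matrix.mul_apply, e1]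
    · rw [← Matrix.mul_apply, Matrix.mul_one]
    · rw [← Matrix.mul_apply, e2]
  have hsum := sum_perm_apply_pair (fun p q => Y p p * Z q q - Y q p * Z p q)
    (fun p => by ring) hab
  rw [← Equiv.sum_comp (Equiv.inv (Equiv.Perm (Fin n)))] at hsum
  simp only [Equiv.inv_apply, Fintype.card_fin, Finset.sum_sub_distrib] at hsum
  have ht : (∑ p, ∑ q, Y p p * Z q q) - ∑ p, ∑ q, Y q p * Z p q =
      Y.trace * Z.trace - (Y * Z).trace := by
    congr 1
    · simp [Matrix.trace, Finset.sum_mul_sum]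
    · rw [Finset.sum_comm]
      simp [Matrix.trace, Matrix.mul_apply]
  rw [ht] at hsum
  have hn0 : (n : ℂ) ≠ 0 := by norm_cast; lia
  have hn1 : (n : ℂ) - 1 ≠ 0 := by
    rw [sub_ne_zero]; norm_cast; lia
  have hf : (n.factorial : ℂ) ≠ 0 := by exact_mod_cast n.factorial_ne_zero
  rw [mixedDisc]
  simp only [hdet]
  rw [← Finset.mul_sum, Finset.sum_sub_distrib]
  rw [← Complex.div_ofReal_re]
  congr 1
  push_cast
  field_simp
  linear_combination A.det * hsum

theorem gram_pair_inequality {m : Type*} [Fintype m] [DecidableEq m] (K M : Matrix m m ℂ)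
    (i j : m) :
    let H := Kᴴ * K
    let N := Mᴴ * M
    (H i i * N j j + H j j * N i i - H i j * N j i - H j i * N i j).re * H.trace.re ≤
      (H i i * (1 : Matrix m m ℂ) j j + H j j * (1 : Matrix m m ℂ) i i
        - H i j * (1 : Matrix m m ℂ) j i - H j i * (1 : Matrix m m ℂ) i j).re *
      (H.trace * N.trace - (H * N).trace).re := by
  intro H N
  rcases eq_or_ne i j with rfl | hij
  · simp
  let v : m → EuclideanSpace ℂ m := fun a => WithLp.toLp 2 (fun r => K r a)
  let c : m → m → ℂ := fun k a => star (M k a)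
  have hH (a b : m) : H a b = inner ℂ (v a) (v b) := by
    simp [H, v, Matrix.mul_apply, PiLp.inner_apply, mul_comm]
  have hHd (a : m) : H a a = ((‖v a‖ ^ 2 : ℝ) : ℂ) := by
    rw [hH, inner_self_eq_norm_sq_to_K]; simp
  have hN (a b : m) : N a b = ∑ k, c k a * star (c k b) := by
    simp [N, c, Matrix.mul_apply]
  have hNd (a : m) : N a a = ((∑ k, ‖c k a‖ ^ 2 : ℝ) : ℂ) := by
    rw [hN]; push_cast
    exact Finset.sum_congr rfl fun k _ => Complex.mul_conj' _
  have hcross (a b : m) : H a b * N b a = ∑ k, inner ℂ (c k a • v a) (c k b • v b) := by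
    rw [hH, hN, Finset.mul_sum]
    refine Finset.sum_congr rfl fun k _ => ?_
    rw [inner_smul_left, inner_smul_right]
    simp only [starRingEnd_apply]
    ring
  have hT : H.trace = ((∑ a, ‖v a‖ ^ 2 : ℝ) : ℂ) := by
    simp [Matrix.trace, hHd]
  have hTN : N.trace = ((∑ k, ∑ a, ‖c k a‖ ^ 2 : ℝ) : ℂ) := by
    rw [Finset.sum_comm]; simp [Matrix.trace, hNd]
  have hHN : (H * N).trace = ((∑ k, ‖∑ a, c k a • v a‖ ^ 2 : ℝ) : ℂ) := by
    simp only [Matrix.trace, Matrix.diag_apply, Matrix.mul_apply, hcross]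
    push_cast
    rw [Finset.sum_congr rfl fun a _ => Finset.sum_comm, Finset.sum_comm]
    refine Finset.sum_congr rfl fun k _ => ?_
    have := inner_self_eq_norm_sq_to_K (𝕜 := ℂ) (∑ a, c k a • v a)
    rw [sum_inner] at this
    simp only [inner_sum] at this
    exact this
  have hsymm : (H j i * N i j).re = (H i j * N j i).re := by
    rw [hcross, hcross, Complex.re_sum, Complex.re_sum]
    exact Finset.sum_congr rfl fun k _ => inner_re_symm (𝕜 := ℂ) _ _
  have hq : (H i i * N j j + H j j * N i i - H i j * N j i - H j i * N i j).re =
      ∑ k, (‖v i‖ ^ 2 * ‖c k j‖ ^ 2 + ‖v j‖ ^ 2 * ‖c k i‖ ^ 2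
        - 2 * (inner ℂ (c k i • v i) (c k j • v j)).re) := by
    rw [Complex.sub_re, Complex.sub_re, hsymm, hcross, Complex.re_sum, Complex.add_re, hHd, hHd,
      hNd, hNd, ← Complex.ofReal_mul, ← Complex.ofReal_mul, Complex.ofReal_re, Complex.ofReal_re,
      Finset.sum_sub_distrib, Finset.sum_add_distrib, ← Finset.mul_sum, ← Finset.mul_sum,
      ← Finset.mul_sum]
    ring
  have hone : (H i i * (1 : Matrix m m ℂ) j j + H j j * (1 : Matrix m m ℂ) i i
        - H i j * (1 : Matrix m m ℂ) j i - H j i * (1 : Matrix m m ℂ) i j).re =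
      ‖v i‖ ^ 2 + ‖v j‖ ^ 2 := by
    rw [hHd, hHd, Matrix.one_apply_ne hij, Matrix.one_apply_ne hij.symm]
    simp only [Matrix.one_apply_eq, mul_one, mul_zero, sub_zero, ← Complex.ofReal_add,
      Complex.ofReal_re]
  rw [hq, hone, hT, hTN, hHN, ← Complex.ofReal_mul, ← Complex.ofReal_sub, Complex.ofReal_re,
    Complex.ofReal_re, Finset.sum_mul, Finset.mul_sum, ← Finset.sum_sub_distrib, Finset.mul_sum]
  exact Finset.sum_le_sum fun k _ => two_plane_gram_inequality v (c k) hij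

theorem trace_diagonal_mul_sub_re {m : Type*} [Fintype m] [DecidableEq m] (b : m → ℝ)
    (H X : Matrix m m ℂ) :
    let D : Matrix m m ℂ := diagonal fun i => (b i : ℂ)
    ((D * H).trace * (D * X).trace - (D * H * (D * X)).trace).re =
      (∑ i, ∑ j, b i * b j *
        (H i i * X j j + H j j * X i i - H i j * X j i - H j i * X i j).re) / 2 := by
  intro D
  have h1 : (D * H).trace * (D * X).trace - (D * H * (D * X)).trace =
      ∑ i, ∑ j, ((b i * b j : ℝ) : ℂ) * (H i i * X j j - H i j * X j i) := by
    simp only [Matrix.trace, Matrix.diag_apply, Matrix.mul_apply (M := D * H), D,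
      Matrix.diagonal_mul, Finset.sum_mul_sum, ← Finset.sum_sub_distrib]
    refine Finset.sum_congr rfl fun i _ => Finset.sum_congr rfl fun j _ => ?_
    push_cast
    ring
  have h2 : ∑ i, ∑ j, b i * b j * (H i i * X j j - H i j * X j i).re =
      ∑ i, ∑ j, b i * b j * (H j j * X i i - H j i * X i j).re := by
    rw [Finset.sum_comm]
    exact Finset.sum_congr rfl fun i _ => Finset.sum_congr rfl fun j _ => by ring
  have h3 : ∑ i, ∑ j, b i * b j *
        (H i i * X j j + H j j * X i i - H i j * X j i - H j i * X i j).re =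
      ∑ i, ∑ j, b i * b j * (H i i * X j j - H i j * X j i).re +
      ∑ i, ∑ j, b i * b j * (H j j * X i i - H j i * X i j).re := by
    simp only [← Finset.sum_add_distrib]
    refine Finset.sum_congr rfl fun i _ => Finset.sum_congr rfl fun j _ => ?_
    simp only [Complex.sub_re, Complex.add_re]
    ring
  rw [h3, ← h2, h1]
  simp only [Complex.re_sum, Complex.re_ofReal_mul]
  ring

open scoped MatrixOrder Matrix.Norms.L2Operator in
theorem Matrix.PosSemidef.exists_eq_conjTranspose_mul_self {m : Type*} [Fintype m]
    [DecidableEq m] {A : Matrix m m ℂ} (hA : A.PosSemidef) : ∃ B : Matrix m m ℂ, A = Bᴴ * B :=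
  CStarAlgebra.nonneg_iff_eq_star_mul_self.1 hA.nonneg

theorem trace_diagonal_inequality {m : Type*} [Fintype m] [DecidableEq m] {b : m → ℝ}
    (hb : ∀ i, 0 ≤ b i) {H N : Matrix m m ℂ} (hH : H.PosSemidef) (hN : N.PosSemidef) :
    let D : Matrix m m ℂ := diagonal fun i => (b i : ℂ)
    ((D * H).trace * (D * N).trace - (D * H * (D * N)).trace).re * H.trace.re ≤
      ((D * H).trace * (D * 1).trace - (D * H * (D * 1)).trace).re *
        (H.trace * N.trace - (H * N).trace).re := by
  intro D
  obtain ⟨K, rfl⟩ := hH.exists_eq_conjTranspose_mul_self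
  obtain ⟨M, rfl⟩ := hN.exists_eq_conjTranspose_mul_self
  rw [trace_diagonal_mul_sub_re, trace_diagonal_mul_sub_re, div_mul_eq_mul_div,
    div_mul_eq_mul_div, Finset.sum_mul, Finset.sum_mul]
  refine div_le_div_of_nonneg_right (Finset.sum_le_sum fun i _ => ?_) zero_le_two
  rw [Finset.sum_mul, Finset.sum_mul]
  refine Finset.sum_le_sum fun j _ => ?_
  rw [mul_assoc (b i * b j), mul_assoc (b i * b j)]
  exact mul_le_mul_of_nonneg_left (gram_pair_inequality K M i j) (mul_nonneg (hb i) (hb j))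

theorem Matrix.PosDef.exists_simultaneous_diagonalization {m : Type*} [Fintype m] [DecidableEq m]
    {P Q : Matrix m m ℂ} (hP : P.PosDef) (hQ : Q.PosSemidef) :
    ∃ (E : Matrix m m ℂ) (b : m → ℝ), IsUnit E ∧ (∀ i, 0 ≤ b i) ∧ P = Eᴴ * E ∧
      Q = Eᴴ * diagonal (fun i => (b i : ℂ)) * E := by
  obtain ⟨C, hC⟩ := hP.posSemidef.exists_eq_conjTranspose_mul_self
  have hCu : IsUnit C.det := by
    have h := (Matrix.isUnit_iff_isUnit_det _).1 hP.isUnit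
    rw [hC, det_mul] at h
    exact isUnit_of_mul_isUnit_right h
  have hB := hQ.conjTranspose_mul_mul_same C⁻¹
  let U : Matrix m m ℂ := hB.1.eigenvectorUnitary
  have hU : U * Uᴴ = 1 := Unitary.mul_star_self_of_mem hB.1.eigenvectorUnitary.2
  have hspec : C⁻¹ᴴ * Q * C⁻¹ = U * diagonal (fun i => (hB.1.eigenvalues i : ℂ)) * Uᴴ :=
    hB.1.spectral_theorem
  have hU' : IsUnit Uᴴ := IsUnit.of_mul_eq_one _ (mul_eq_one_comm.1 hU)
  refine ⟨Uᴴ * C, hB.1.eigenvalues, hU'.mul ((Matrix.isUnit_iff_isUnit_det _).2 hCu),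
    hB.eigenvalues_nonneg, ?_, ?_⟩
  · rw [conjTranspose_mul, conjTranspose_conjTranspose, Matrix.mul_assoc, ← Matrix.mul_assoc U, hU,
      Matrix.one_mul, hC]
  · have h1 : C⁻¹ * C = 1 := nonsing_inv_mul _ hCu
    have h2 : Cᴴ * C⁻¹ᴴ = 1 := by rw [← conjTranspose_mul, h1, conjTranspose_one]
    calc Q = (Cᴴ * C⁻¹ᴴ) * Q * (C⁻¹ * C) := by rw [h1, h2, Matrix.one_mul, Matrix.mul_one]
      _ = Cᴴ * (C⁻¹ᴴ * Q * C⁻¹) * C := by simp only [Matrix.mul_assoc]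
      _ = Cᴴ * (U * diagonal (fun i => (hB.1.eigenvalues i : ℂ)) * Uᴴ) * C :=
        congrArg (fun X => Cᴴ * X * C) hspec
      _ = _ := by
        rw [conjTranspose_mul, conjTranspose_conjTranspose]
        simp only [Matrix.mul_assoc]

theorem trace_inequality_of_posDef {m : Type*} [Fintype m] [DecidableEq m]
    {H W A N : Matrix m m ℂ} (hH : H.PosSemidef) (hW : W.PosDef) (hA : A.PosDef)
    (hN : N.PosSemidef) :
    ((A⁻¹ * H).trace * (A⁻¹ * N).trace - (A⁻¹ * H * (A⁻¹ * N)).trace).re * (W⁻¹ * H).trace.re ≤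
      ((A⁻¹ * H).trace * (A⁻¹ * W).trace - (A⁻¹ * H * (A⁻¹ * W)).trace).re *
        ((W⁻¹ * H).trace * (W⁻¹ * N).trace - (W⁻¹ * H * (W⁻¹ * N)).trace).re := by
  obtain ⟨E, b, hE, hb, hWE, hAE⟩ :=
    hW.inv.exists_simultaneous_diagonalization hA.inv.posSemidef
  set D : Matrix m m ℂ := diagonal fun i => (b i : ℂ)
  have hEWE : E * W * Eᴴ = 1 := by
    have h1 : W⁻¹ * W = 1 :=
      nonsing_inv_mul _ ((Matrix.isUnit_iff_isUnit_det _).1 hW.isUnit)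
    rw [hWE, Matrix.mul_assoc] at h1
    exact mul_eq_one_comm.1 h1
  have key := trace_diagonal_inequality hb (hH.mul_mul_conjTranspose_same E)
    (hN.mul_mul_conjTranspose_same E)
  rw [← hEWE] at key
  have t1 (B X : Matrix m m ℂ) : (Eᴴ * B * E * X).trace = (B * (E * X * Eᴴ)).trace := by
    rw [Matrix.mul_assoc, Matrix.mul_assoc, trace_mul_comm]
    simp only [Matrix.mul_assoc]
  have t2 (B X Y : Matrix m m ℂ) : (Eᴴ * B * E * X * (Eᴴ * B * E * Y)).trace =
      (B * (E * X * Eᴴ) * (B * (E * Y * Eᴴ))).trace := by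
    have := t1 B (X * (Eᴴ * B * E * Y))
    simp only [Matrix.mul_assoc] at this ⊢
    exact this
  have hWE' : W⁻¹ = Eᴴ * 1 * E := by rw [Matrix.mul_one, hWE]
  rw [hWE', hAE]
  simp only [t1, t2]
  simpa only [Matrix.one_mul] using key

/-- Constant-coefficient form of the restricted reverse Khovanskii–Teissier inequality with
an auxiliary polarization: for positive definite Hermitian matrices `H, W, A`, a positive
semidefinite Hermitian matrix `N`, and `n ≥ 2`, one has
`(n−1) · D(H, A^{[n−2]}, W) · D(H, W^{[n−2]}, N) ≥ D(H, A^{[n−2]}, N) · D(H, W^{[n−1]})`. -/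
theorem pointwise_restricted_reverse_KT_aux (n : ℕ) (hn : 2 ≤ n)
    (H W A N : Matrix (Fin n) (Fin n) ℂ)
    (hH : H.PosDef) (hW : W.PosDef) (hA : A.PosDef) (hN : N.PosSemidef) :
    ((n : ℝ) - 1) * mixedDisc n (blocks3 n 1 (n - 2) H A W) *
      mixedDisc n (blocks3 n 1 (n - 2) H W N) ≥
    mixedDisc n (blocks3 n 1 (n - 2) H A N) *
      mixedDisc n (blocks3 n 1 (n - 1) H W W) := by

  have hblocks : blocks3 n 1 (n - 1) H W W = blocks3 n 1 (n - 2) H W W := by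
    funext i
    simp only [blocks3, ite_self]
  have hAu := (Matrix.isUnit_iff_isUnit_det _).1 hA.isUnit
  have hWu := (Matrix.isUnit_iff_isUnit_det _).1 hW.isUnit
  have hre {B : Matrix (Fin n) (Fin n) ℂ} (hB : B.PosDef) (z : ℂ) :
      (B.det * z).re = B.det.re * z.re := by
    have := (Complex.pos_iff.1 hB.det_pos).2
    rw [Complex.mul_re, ← this, zero_mul, sub_zero]
  rw [hblocks, mixedDisc_blocks3 hn H A W hAu, mixedDisc_blocks3 hn H W N hWu,
    mixedDisc_blocks3 hn H A N hAu, mixedDisc_blocks3 hn H W W hWu, hre hA, hre hW, hre hA, hre hW,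
    nonsing_inv_mul _ hWu, Matrix.mul_one, trace_one, Fintype.card_fin]
  have key := trace_inequality_of_posDef hH.posSemidef hW hA hN
  have hW1 : ((W⁻¹ * H).trace * (n : ℂ) - (W⁻¹ * H).trace).re =
      ((n : ℝ) - 1) * (W⁻¹ * H).trace.re := by
    rw [Complex.sub_re, mul_comm, ← Complex.ofReal_natCast, Complex.re_ofReal_mul]
    ring
  rw [hW1]
  have hn1 : (0 : ℝ) ≤ (n : ℝ) - 1 := by
    rw [sub_nonneg]; exact_mod_cast le_trans one_le_two hn
  have hdA := (Complex.pos_iff.1 hA.det_pos).1.le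
  have hdW := (Complex.pos_iff.1 hW.det_pos).1.le
  generalize (n : ℝ) * (n - 1) = d
  have hc : 0 ≤ ((n : ℝ) - 1) * A.det.re * W.det.re / (d * d) :=
    div_nonneg (mul_nonneg (mul_nonneg hn1 hdA) hdW) (mul_self_nonneg d)
  refine le_of_eq_of_le ?_ ((mul_le_mul_of_nonneg_left key hc).trans_eq ?_) <;> ring
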